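/- Let A = (a_{ij}) be an n×n real matrix with a_{ij} ≥ 0 for all i ≠ j and a_{ii} > 0 for all i, and let b = (b_j) be a vector with b_j > 0 for all j. If for every i we have b_i > Σ_{j≠i} a_{ij} · (b_j / a_{jj}), then A is invertible and the vector A⁻¹ b has all entries strictly positive. -/

import Mathlib

open Matrix

theorem kaykobad (n : ℕ) (A : Matrix (Fin n) (Fin n) ℝ) (b : Fin n → ℝ)
    (hoff : ∀ i j, i ≠ j → 0 ≤ A i j) (hdiag : ∀ i, 0 < A i i)
    (hb : ∀ j, 0 < b j)
    (hdom : ∀ i, b i > ∑ j ∈ Finset.univ.erase i, A i j * (b j / A j j)) :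
    IsUnit A.det ∧ ∀ i, 0 < (A⁻¹ *ᵥ b) i := by
  have hd : ∀ j, 0 < b j / A j j := fun j => div_pos (hb j) (hdiag j)
  have hdA : ∀ j, A j j * (b j / A j j) = b j := fun j => by
    have := (hdiag j).ne'
    field_simp
  have hdet : A.det ≠ 0 := by
    have h1 : (A * Matrix.diagonal (fun j => b j / A j j)).det ≠ 0 := by
      apply det_ne_zero_of_sum_row_lt_diag
      intro k
      simp only [Matrix.mul_diagonal]
      rw [hdA, Real.norm_of_nonneg (hb k).le]
      refine lt_of_eq_of_lt (Finset.sum_congr rfl fun j hj => ?_) (hdom k)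
      exact Real.norm_of_nonneg
        (mul_nonneg (hoff k j (Finset.ne_of_mem_erase hj).symm) (hd j).le)
    rw [Matrix.det_mul] at h1
    exact left_ne_zero_of_mul h1
  have hu : IsUnit A.det := isUnit_iff_ne_zero.mpr hdet
  refine ⟨hu, ?_⟩
  intro i0
  set x := A⁻¹ *ᵥ b with hx
  have hAx : A *ᵥ x = b := by
    rw [hx, Matrix.mulVec_mulVec, Matrix.mul_nonsing_inv A hu, Matrix.one_mulVec]
  obtain ⟨y, hy⟩ : ∃ y : Fin n → ℝ, ∀ j, x j = (b j / A j j) * y j :=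
    ⟨fun j => x j / (b j / A j j), fun j => (mul_div_cancel₀ _ (hd j).ne').symm⟩
  have hrow : ∀ i, b i * y i + ∑ j ∈ Finset.univ.erase i, A i j * (b j / A j j) * y j = b i := by
    intro i
    have h := congrFun hAx i
    simp only [Matrix.mulVec, dotProduct] at h
    rw [← Finset.add_sum_erase _ _ (Finset.mem_univ i)] at h
    simp only [hy, ← mul_assoc (A _ _)] at h
    rwa [hdA] at h
  have hM : ∀ i, ∀ j ∈ Finset.univ.erase i, 0 ≤ A i j * (b j / A j j) := fun i j hj =>
    mul_nonneg (hoff i j (Finset.ne_of_mem_erase hj).symm) (hd j).le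
  haveI : Nonempty (Fin n) := ⟨i0⟩
  obtain ⟨p, hp⟩ := Finite.exists_max y
  obtain ⟨q, hq⟩ := Finite.exists_min y
  rw [hy]
  apply mul_pos (hd i0)
  refine lt_of_lt_of_le ?_ (hq i0)
  by_contra! hm
  have h1 : ∑ j ∈ Finset.univ.erase q, A q j * (b j / A j j) * y j
      ≤ (∑ j ∈ Finset.univ.erase q, A q j * (b j / A j j)) * y p := by
    rw [Finset.sum_mul]
    exact Finset.sum_le_sum fun j hj => mul_le_mul_of_nonneg_left (hp j) (hM q j hj)
  have h2 : (∑ j ∈ Finset.univ.erase p, A p j * (b j / A j j)) * y q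
      ≤ ∑ j ∈ Finset.univ.erase p, A p j * (b j / A j j) * y j := by
    rw [Finset.sum_mul]
    exact Finset.sum_le_sum fun j hj => mul_le_mul_of_nonneg_left (hq j) (hM p j hj)
  have hsq := Finset.sum_nonneg (hM q)
  have e1 := hrow q
  have e2 := hrow p
  have d1 := hdom q
  have d2 := hdom p
  have bq := hb q
  have bp := hb p
  generalize ∑ j ∈ Finset.univ.erase q, A q j * (b j / A j j) = s at *
  generalize ∑ j ∈ Finset.univ.erase p, A p j * (b j / A j j) = t at *
  have k1 : b q * (1 - y q) ≤ s * y p := by linarith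
  have k2 : 0 < b q * (1 - y q) := mul_pos bq (by linarith)
  have k3 : 0 < y p := pos_of_mul_pos_right (lt_of_lt_of_le k2 k1) hsq
  have k4 : b q * (1 - y q) < b q * y p := lt_of_le_of_lt k1 (mul_lt_mul_of_pos_right d1 k3)
  have k5 := lt_of_mul_lt_mul_left k4 bq.le
  have k6 : b p * y q ≤ t * y q := mul_le_mul_of_nonpos_right d2.le hm
  have k7 : b p * (y p + y q) ≤ b p * 1 := by linarith
  have k8 := le_of_mul_le_mul_left k7 bp
  linarith
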